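/- Let a ∈ ℝ, let P : (a, ∞) → ℝ be continuous, and let A₁, A₂ : (a, ∞) → ℝ be twice differentiable solutions of A'' + P·A = 0 on (a, ∞) such that M(x) := √(A₁(x)² + A₂(x)²) > 0 for all x > a. Let Ψ : (a, ∞) → ℝ be a differentiable function with A₁(x) = M(x)·cos Ψ(x), A₂(x) = M(x)·sin Ψ(x), and assume Ψ'(x) > 0 for all x > a. Then for every t ∈ ℝ, the function F(x) := cos(Ψ(x) − πt)/√(Ψ'(x)) is twice differentiable on (a, ∞) and satisfies F''(x) + P(x)·F(x) = 0 there. -/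

import Mathlib

open Set Filter Topology

/-- The Wronskian of two solutions of `A'' + P · A = 0` on `(a, ∞)` is constant. -/
theorem wronskian_eq_of_schrodinger {a : ℝ} {P A₁ A₂ : ℝ → ℝ}
    (hA₁ : ∀ x, a < x → DifferentiableAt ℝ A₁ x)
    (hA₁' : ∀ x, a < x → DifferentiableAt ℝ (deriv A₁) x)
    (hA₂ : ∀ x, a < x → DifferentiableAt ℝ A₂ x)
    (hA₂' : ∀ x, a < x → DifferentiableAt ℝ (deriv A₂) x)
    (heq₁ : ∀ x, a < x → deriv (deriv A₁) x + P x * A₁ x = 0)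
    (heq₂ : ∀ x, a < x → deriv (deriv A₂) x + P x * A₂ x = 0)
    {x y : ℝ} (hx : a < x) (hy : a < y) :
    A₁ y * deriv A₂ y - deriv A₁ y * A₂ y = A₁ x * deriv A₂ x - deriv A₁ x * A₂ x := by
  have hd (z : ℝ) (hz : a < z) :
      HasDerivAt (fun u => A₁ u * deriv A₂ u - deriv A₁ u * A₂ u) 0 z := by
    refine (((hA₁ z hz).hasDerivAt.fun_mul (hA₂' z hz).hasDerivAt).fun_sub
      ((hA₁' z hz).hasDerivAt.fun_mul (hA₂ z hz).hasDerivAt)).congr_deriv ?_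
    linear_combination A₁ z * heq₂ z hz - A₂ z * heq₁ z hz
  exact isOpen_Ioi.is_const_of_deriv_eq_zero isPreconnected_Ioi
    (fun z hz => (hd z hz).differentiableAt.differentiableWithinAt)
    (fun z hz => (hd z hz).deriv) hy hx

/-- If `(A, B) = r · (cos θ, sin θ)` near `x`, then `A B' - A' B = r² θ'` at `x`. -/
theorem wronskian_eq_sq_mul_deriv_phase {A B r θ : ℝ → ℝ} {x : ℝ}
    (hA : DifferentiableAt ℝ A x) (hB : DifferentiableAt ℝ B x) (hθ : DifferentiableAt ℝ θ x)
    (hcos : ∀ᶠ y in 𝓝 x, A y = r y * Real.cos (θ y))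
    (hsin : ∀ᶠ y in 𝓝 x, B y = r y * Real.sin (θ y)) :
    A x * deriv B x - deriv A x * B x = r x ^ 2 * deriv θ x := by
  have h₁ := hA.hasDerivAt.fun_mul hθ.hasDerivAt.sin
  have h₂ := hB.hasDerivAt.fun_mul hθ.hasDerivAt.cos
  have heq : (fun y => A y * Real.sin (θ y)) =ᶠ[𝓝 x] fun y => B y * Real.cos (θ y) := by
    filter_upwards [hcos, hsin] with y hc hs
    rw [hc, hs]
    ring
  have h := h₁.unique (h₂.congr_of_eventuallyEq heq)
  rw [hcos.self_of_nhds, hsin.self_of_nhds] at h ⊢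
  linear_combination -r x * h + r x ^ 2 * deriv θ x * Real.sin_sq_add_cos_sq (θ x)

/-- If `Ψ` is a phase function (with positive derivative) of two solutions `A₁, A₂` of a
Schrödinger equation with potential `P` on `(a, ∞)`, then for any `t ∈ ℝ` the function
`F(x) = cos(Ψ(x) - πt)/√(Ψ'(x))` is twice differentiable and satisfies the same
Schrödinger equation `F'' + P · F = 0` on `(a, ∞)`. -/
theorem phase_combination_solves_schrodinger
    (a : ℝ) (P A₁ A₂ Ψ : ℝ → ℝ)
    (hP : ContinuousOn P (Set.Ioi a))
    (hA₁ : ∀ x, a < x → DifferentiableAt ℝ A₁ x)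
    (hA₁' : ∀ x, a < x → DifferentiableAt ℝ (deriv A₁) x)
    (hA₂ : ∀ x, a < x → DifferentiableAt ℝ A₂ x)
    (hA₂' : ∀ x, a < x → DifferentiableAt ℝ (deriv A₂) x)
    (heq₁ : ∀ x, a < x → deriv (deriv A₁) x + P x * A₁ x = 0)
    (heq₂ : ∀ x, a < x → deriv (deriv A₂) x + P x * A₂ x = 0)
    (hM : ∀ x, a < x → 0 < Real.sqrt ((A₁ x) ^ 2 + (A₂ x) ^ 2))
    (hΨ : ∀ x, a < x → DifferentiableAt ℝ Ψ x)
    (hcos : ∀ x, a < x → A₁ x = Real.sqrt ((A₁ x) ^ 2 + (A₂ x) ^ 2) * Real.cos (Ψ x))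
    (hsin : ∀ x, a < x → A₂ x = Real.sqrt ((A₁ x) ^ 2 + (A₂ x) ^ 2) * Real.sin (Ψ x))
    (hΨ' : ∀ x, a < x → 0 < deriv Ψ x) (t : ℝ) :
    ∀ x, a < x →
      DifferentiableAt ℝ (fun y => Real.cos (Ψ y - Real.pi * t) / Real.sqrt (deriv Ψ y)) x ∧
      DifferentiableAt ℝ
        (deriv (fun y => Real.cos (Ψ y - Real.pi * t) / Real.sqrt (deriv Ψ y))) x ∧
      deriv (deriv (fun y => Real.cos (Ψ y - Real.pi * t) / Real.sqrt (deriv Ψ y))) x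
        + P x * (Real.cos (Ψ x - Real.pi * t) / Real.sqrt (deriv Ψ x)) = 0 := by
  intro x hx
  set W := A₁ x * deriv A₂ x - deriv A₁ x * A₂ x with hW
  have hwr (y : ℝ) (hy : a < y) : W = √(A₁ y ^ 2 + A₂ y ^ 2) ^ 2 * deriv Ψ y := by
    rw [hW, wronskian_eq_of_schrodinger hA₁ hA₁' hA₂ hA₂' heq₁ heq₂ hy hx]
    exact wronskian_eq_sq_mul_deriv_phase (r := fun u => √(A₁ u ^ 2 + A₂ u ^ 2))
      (hA₁ y hy) (hA₂ y hy) (hΨ y hy)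
      (eventually_of_mem (Ioi_mem_nhds hy) hcos) (eventually_of_mem (Ioi_mem_nhds hy) hsin)
  set c := Real.cos (Real.pi * t) / √W
  set d := Real.sin (Real.pi * t) / √W
  have hF (y : ℝ) (hy : a < y) :
      Real.cos (Ψ y - Real.pi * t) / √(deriv Ψ y) = c * A₁ y + d * A₂ y := by
    have hsqrt : √W = √(A₁ y ^ 2 + A₂ y ^ 2) * √(deriv Ψ y) := by
      rw [hwr y hy, Real.sqrt_mul (sq_nonneg _), Real.sqrt_sq (hM y hy).le]
    have hM' := (hM y hy).ne'
    have hΨ₀ := (Real.sqrt_pos.2 (hΨ' y hy)).ne'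
    have hc := hcos y hy
    have hs := hsin y hy
    simp only [c, d, hsqrt, Real.cos_sub]
    generalize √(A₁ y ^ 2 + A₂ y ^ 2) = M at *
    rw [hc, hs]
    field_simp
  have hd (y : ℝ) (hy : a < y) :
      HasDerivAt (fun y => Real.cos (Ψ y - Real.pi * t) / √(deriv Ψ y))
        (c * deriv A₁ y + d * deriv A₂ y) y :=
    (((hA₁ y hy).hasDerivAt.const_mul c).fun_add
      ((hA₂ y hy).hasDerivAt.const_mul d)).congr_of_eventuallyEq
      (eventually_of_mem (Ioi_mem_nhds hy) hF)
  have hdd : HasDerivAt (deriv fun y => Real.cos (Ψ y - Real.pi * t) / √(deriv Ψ y))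
      (c * deriv (deriv A₁) x + d * deriv (deriv A₂) x) x :=
    (((hA₁' x hx).hasDerivAt.const_mul c).fun_add
      ((hA₂' x hx).hasDerivAt.const_mul d)).congr_of_eventuallyEq
      (eventually_of_mem (Ioi_mem_nhds hx) fun y hy => (hd y hy).deriv)
  refine ⟨(hd x hx).differentiableAt, hdd.differentiableAt, ?_⟩
  rw [hdd.deriv, hF x hx]
  linear_combination c * heq₁ x hx + d * heq₂ x hx
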